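/- Let A be a J-algebra and a, b ∈ A with a˘;a ≤ 1', b˘;b ≤ 1', 1 = a˘;b, 1 = a;1 = b;1, and (a;a˘)·(b;b˘) ≤ 1'. Define x⊗y = (a;x;a˘)·(b;y;b˘). If x and y are permutational, then x⊗y is permutational. -/

import Mathlib

/-- A J-algebra: an algebra (A, ·, 0, 1, ;, ˘, 1') satisfying Jónsson's axioms. -/
structure JAlgebra (A : Type*) where
  meet : A → A → A        -- Boolean product ·
  comp : A → A → A        -- relative product ;
  conv : A → A            -- converse ˘
  zero : A                -- 0
  one : A                 -- 1
  ident : A               -- 1'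
  massoc : ∀ x y z, meet x (meet y z) = meet (meet x y) z
  mcomm : ∀ x y, meet x y = meet y x
  midem : ∀ x, meet x x = x
  cassoc : ∀ x y z, comp x (comp y z) = comp (comp x y) z
  cid : ∀ x, comp x ident = x
  semidist : ∀ x y z, comp (meet x y) z = meet (comp (meet x y) z) (comp y z)
  convconv : ∀ x, conv (conv x) = x
  convcomp : ∀ x y, conv (comp x y) = comp (conv y) (conv x)
  convmeet : ∀ x y, conv (meet x y) = meet (conv x) (conv y)
  rot : ∀ x y z, meet (comp x y) z =
    meet (comp (meet (comp z (conv y)) x) (meet y (comp (conv x) z))) z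
  zbot : ∀ x, meet zero x = zero
  otop : ∀ x, meet x one = x
  comp_zero : ∀ x, comp x zero = zero

/-- x ≤ y iff x·y = x. -/
def JAlgebra.le {A : Type*} (J : JAlgebra A) (x y : A) : Prop := J.meet x y = x

/-- x is functional iff x˘;x ≤ 1'. -/
def JAlgebra.Functional {A : Type*} (J : JAlgebra A) (x : A) : Prop :=
  J.le (J.comp (J.conv x) x) J.ident

/-- x is permutational iff x;x˘ = 1' = x˘;x. -/
def JAlgebra.Permutational {A : Type*} (J : JAlgebra A) (x : A) : Prop :=
  J.comp x (J.conv x) = J.ident ∧ J.comp (J.conv x) x = J.ident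

/-- Parallel composition x⊗y = (a;x;a˘)·(b;y;b˘) with parameters a, b. -/
def JAlgebra.otimes {A : Type*} (J : JAlgebra A) (a b x y : A) : A :=
  J.meet (J.comp (J.comp a x) (J.conv a)) (J.comp (J.comp b y) (J.conv b))

namespace JAlgebra

variable {A : Type*} (J : JAlgebra A)

lemma le_trans {x y z : A} (h : J.le x y) (h' : J.le y z) : J.le x z := by
  unfold le at *
  rw [← h, ← J.massoc, h']

lemma le_antisymm {x y : A} (h : J.le x y) (h' : J.le y x) : x = y := by
  unfold le at *
  rw [← h, J.mcomm, h']

lemma meet_le_left (x y : A) : J.le (J.meet x y) x := by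
  unfold le
  rw [J.mcomm, J.massoc, J.midem]

lemma meet_le_right (x y : A) : J.le (J.meet x y) y := by
  unfold le
  rw [← J.massoc, J.midem]

lemma le_meet {x y z : A} (h : J.le x y) (h' : J.le x z) : J.le x (J.meet y z) := by
  unfold le at *
  rw [J.massoc, h, h']

lemma conv_le_conv {x y : A} (h : J.le x y) : J.le (J.conv x) (J.conv y) := by
  unfold le at *
  rw [← J.convmeet, h]

lemma comp_le_comp_right {x y : A} (h : J.le x y) (z : A) :
    J.le (J.comp x z) (J.comp y z) := by
  have hs := J.semidist x y z
  unfold le at *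
  rw [h] at hs
  exact hs.symm

lemma comp_le_comp_left {x y : A} (h : J.le x y) (z : A) :
    J.le (J.comp z x) (J.comp z y) := by
  have hc := J.conv_le_conv (J.comp_le_comp_right (J.conv_le_conv h) (J.conv z))
  simpa only [J.convcomp, J.convconv] using hc

lemma comp_le_comp {x y z w : A} (h : J.le x y) (h' : J.le z w) :
    J.le (J.comp x z) (J.comp y w) :=
  J.le_trans (J.comp_le_comp_right h z) (J.comp_le_comp_left h' y)

lemma conv_ident_comp (x : A) : J.comp (J.conv J.ident) x = x := by
  rw [← J.convconv x, ← J.convcomp, J.cid]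

lemma conv_ident : J.conv J.ident = J.ident := by
  rw [← J.cid (J.conv J.ident), J.conv_ident_comp]

lemma ident_comp (x : A) : J.comp J.ident x = x := by
  simpa only [J.conv_ident] using J.conv_ident_comp x

/-- The Dedekind law below the identity. -/
lemma ident_le_of_ident_le_comp {x y : A} (h : J.le J.ident (J.comp x y)) :
    J.le J.ident (J.comp (J.meet (J.conv y) x) (J.meet y (J.conv x))) := by
  have hr := J.rot x y J.ident
  rw [J.ident_comp, J.cid, J.mcomm, show J.meet J.ident (J.comp x y) = J.ident from h] at hr
  rw [le, J.mcomm]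
  exact hr.symm

lemma ident_le_comp_conv_of_total {x : A} (h : J.one = J.comp x J.one) :
    J.le J.ident (J.comp x (J.conv x)) :=
  J.le_trans (J.ident_le_of_ident_le_comp (h ▸ J.otop J.ident))
    (J.comp_le_comp (J.meet_le_right _ _) (J.meet_le_right _ _))

lemma comp_comp_conv_self {x : A} (hx : J.comp x (J.conv x) = J.ident) (a : A) :
    J.comp (J.comp a x) (J.conv (J.comp a x)) = J.comp a (J.conv a) := by
  rw [J.convcomp, ← J.cassoc, J.cassoc x, hx, J.ident_comp]

lemma conv_otimes (a b x y : A) :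
    J.conv (J.otimes a b x y) = J.otimes a b (J.conv x) (J.conv y) := by
  simp only [otimes, J.convmeet, J.convcomp, J.convconv, J.cassoc]

lemma conj_comp_conj_le {a x : A} (ha : J.Functional a) (hx : J.comp x (J.conv x) = J.ident) :
    J.le (J.comp (J.comp (J.comp a x) (J.conv a)) (J.comp (J.comp a (J.conv x)) (J.conv a)))
      (J.comp a (J.conv a)) := by
  have h := J.comp_le_comp_left
    (J.comp_le_comp_right ha (J.comp (J.conv x) (J.conv a))) (J.comp a x)
  rw [J.ident_comp, ← J.convcomp, J.comp_comp_conv_self hx, J.convcomp] at h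
  simpa only [J.cassoc] using h

lemma ident_le_otimes_comp_conv {a b x y : A}
    (hQ : J.one = J.comp (J.conv a) b)
    (hDa : J.one = J.comp a J.one) (hDb : J.one = J.comp b J.one)
    (hx : J.comp x (J.conv x) = J.ident) (hy : J.comp y (J.conv y) = J.ident) :
    J.le J.ident (J.comp (J.otimes a b x y) (J.conv (J.otimes a b x y))) := by
  have hp := J.ident_le_comp_conv_of_total hDa
  have hq := J.ident_le_comp_conv_of_total hDb
  rw [← J.comp_comp_conv_self hx] at hp
  rw [← J.comp_comp_conv_self hy] at hq
  have hpq := J.comp_le_comp hp hq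
  rw [J.cid, ← J.cassoc, J.cassoc (J.conv _)] at hpq
  have h := J.le_trans hpq (J.comp_le_comp_left (J.comp_le_comp_right (J.otop _) _) _)
  have heq : J.comp (J.comp a x) (J.comp J.one (J.conv (J.comp b y))) =
      J.comp (J.comp (J.comp a x) (J.conv a)) (J.conv (J.comp (J.comp b y) (J.conv b))) := by
    rw [hQ, J.convcomp (J.comp b y), J.convconv]
    simp only [J.cassoc]
  rw [heq] at h
  have hd := J.ident_le_of_ident_le_comp h
  rw [J.convconv, J.mcomm, J.mcomm (J.conv _), ← J.convmeet] at hd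
  exact hd

lemma otimes_comp_conv {a b x y : A} (ha : J.Functional a) (hb : J.Functional b)
    (hQ : J.one = J.comp (J.conv a) b)
    (hDa : J.one = J.comp a J.one) (hDb : J.one = J.comp b J.one)
    (hU : J.le (J.meet (J.comp a (J.conv a)) (J.comp b (J.conv b))) J.ident)
    (hx : J.comp x (J.conv x) = J.ident) (hy : J.comp y (J.conv y) = J.ident) :
    J.comp (J.otimes a b x y) (J.conv (J.otimes a b x y)) = J.ident := by
  refine J.le_antisymm ?_ (J.ident_le_otimes_comp_conv hQ hDa hDb hx hy)
  rw [conv_otimes]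
  refine J.le_trans (J.le_meet ?_ ?_) hU
  · exact J.le_trans (J.comp_le_comp (J.meet_le_left _ _) (J.meet_le_left _ _))
      (J.conj_comp_conj_le ha hx)
  · exact J.le_trans (J.comp_le_comp (J.meet_le_right _ _) (J.meet_le_right _ _))
      (J.conj_comp_conj_le hb hy)

end JAlgebra

/-- If a, b satisfy (Q), (D), and (U), then the permutational elements are
closed under ⊗. -/
theorem otimes_permutational {A : Type*} (J : JAlgebra A) (a b : A)
    (ha : J.le (J.comp (J.conv a) a) J.ident)
    (hb : J.le (J.comp (J.conv b) b) J.ident)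
    (hQ : J.one = J.comp (J.conv a) b)
    (hDa : J.one = J.comp a J.one)
    (hDb : J.one = J.comp b J.one)
    (hU : J.le (J.meet (J.comp a (J.conv a)) (J.comp b (J.conv b))) J.ident)
    (x y : A) (hx : J.Permutational x) (hy : J.Permutational y) :
    J.Permutational (J.otimes a b x y) := by
  refine ⟨J.otimes_comp_conv ha hb hQ hDa hDb hU hx.1 hy.1, ?_⟩
  have h := J.otimes_comp_conv (x := J.conv x) (y := J.conv y) ha hb hQ hDa hDb hU
    (by rw [J.convconv, hx.2]) (by rw [J.convconv, hy.2])
  rwa [← J.conv_otimes, J.convconv] at h
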